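/- Let 1 ≤ b ≤ a ≤ d with b < d, and let 1 ≤ c < a. Let ψ, φ : [1,∞) → (0,∞) be decreasing functions tending to 0 with ψ(T) ≤ T^{−b/(d−b)} for all T ≥ 1, and define μ_T, M_T, λ_T as in the context. Assume the series Σ_{T=1}^∞ λ_T · φ(T)^{a−c}/T^{a−c} converges. Suppose B is a b-dimensional linear subspace of ℝ^d with dist(z, B) ≥ ψ(|z|) for every nonzero z ∈ ℤ^d, and let A ⊇ B be any a-dimensional linear subspace of ℝ^d. Then for Lebesgue-almost every Θ ∈ ℝ^{(a−c)×c} there are only finitely many z ∈ ℤ^d \ {0} with dist(z, C(Θ)) < φ(|z|); in particular, for almost every Θ there exists ρ ∈ (0,1] such that C(Θ) is (ρφ)-badly approximable. -/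

import Mathlib

open MeasureTheory Filter

noncomputable section

/-- The sup-norm of a vector in Euclidean space. -/
def supNorm {d : ℕ} (w : EuclideanSpace ℝ (Fin d)) : ℝ := ⨆ i, |w i|

/-- The point of `ℝ^d` (with Euclidean metric) corresponding to an integer vector. -/
def intVec {d : ℕ} (z : Fin d → ℤ) : EuclideanSpace ℝ (Fin d) :=
  (WithLp.equiv 2 (Fin d → ℝ)).symm (fun i => (z i : ℝ))

/-- The irrationality measure function `ψ_B` of a linear subspace of `ℝ^d`:
`ψ_B(t) = inf { dist(z, B) : z ∈ ℤ^d, 1 ≤ |z| < t }`. -/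
def psiSub {d : ℕ} (B : Submodule ℝ (EuclideanSpace ℝ (Fin d))) (t : ℝ) : ℝ :=
  sInf ((fun z : Fin d → ℤ =>
      Metric.infDist (intVec z) (B : Set (EuclideanSpace ℝ (Fin d)))) ''
    {z | 1 ≤ supNorm (intVec z) ∧ supNorm (intVec z) < t})

/-- The Diophantine exponent of a linear subspace of `ℝ^d`:
`ω(B) = sup { γ : liminf_{t→∞} t^γ ψ_B(t) < ∞ }`, as an extended real number. -/
def diophExp {d : ℕ} (B : Submodule ℝ (EuclideanSpace ℝ (Fin d))) : EReal :=
  sSup {x : EReal | ∃ γ : ℝ, x = (γ : EReal) ∧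
    Filter.liminf (fun t : ℝ => ENNReal.ofReal (t ^ γ * psiSub B t)) Filter.atTop < ⊤}

/-- The graph subspace `C(Θ)` of an `(a-c)×c` matrix `Θ`, relative to an orthonormal
basis `e` of an `a`-dimensional subspace of `ℝ^d`:
`C(Θ) = { ∑ x_j e_j + ∑_i (∑_j θ_{ij} x_j) e_{c+i} : x ∈ ℝ^c }`. -/
def graphSub (d a c : ℕ) (hca : c ≤ a) (e : Fin a → EuclideanSpace ℝ (Fin d))
    (Θ : Fin (a - c) → Fin c → ℝ) : Submodule ℝ (EuclideanSpace ℝ (Fin d)) :=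
  Submodule.span ℝ {v | ∃ x : Fin c → ℝ,
    v = (∑ j : Fin c, x j • e (Fin.castLE hca j)) +
        ∑ i : Fin (a - c), (∑ j : Fin c, Θ i j * x j) • e ⟨c + i.1, by have := i.2; omega⟩}

/-- `μ_T = (T/ψ(T))^{a−b} · max{1, (φ(T)/ψ(T))^{d−a}}` for `T ≥ 1`, and `μ_T = 0` for `T < 1`. -/
def muF (a b d : ℕ) (ψ φ : ℝ → ℝ) (T : ℝ) : ℝ :=
  if T < 1 then 0 else (T / ψ T) ^ (a - b) * max 1 ((φ T / ψ T) ^ (d - a))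

/-- `M_T = Σ_{j=0}^{⌊log₂ T⌋} μ_{T/2^j}` for integers `T ≥ 1` (and `M_0 = 0`). -/
def MF (a b d : ℕ) (ψ φ : ℝ → ℝ) (T : ℕ) : ℝ :=
  ∑ j ∈ Finset.range (Nat.log 2 T + 1), muF a b d ψ φ ((T : ℝ) / 2 ^ j)

/-- `λ_T = M_T − M_{T−1}` for integers `T ≥ 1`. -/
def lamF (a b d : ℕ) (ψ φ : ℝ → ℝ) (T : ℕ) : ℝ :=
  MF a b d ψ φ T - MF a b d ψ φ (T - 1)

section Projections

variable {E : Type*} [NormedAddCommGroup E] [InnerProductSpace ℝ E] [FiniteDimensional ℝ E]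

/-- The coordinates of the orthogonal projection of a vector onto a subspace of dimension `n`,
in an orthonormal basis of the subspace. -/
def projCoord (V : Submodule ℝ E) {n : ℕ} (h : Module.finrank ℝ V = n) (w : E) (i : Fin n) : ℝ :=
  inner ℝ ((stdOrthonormalBasis ℝ V (finCongr h.symm i) : V) : E) w

lemma projCoord_sub (V : Submodule ℝ E) {n : ℕ} (h : Module.finrank ℝ V = n) (w w' : E)
    (i : Fin n) : projCoord V h (w - w') i = projCoord V h w i - projCoord V h w' i :=
  inner_sub_right _ _ _

lemma projCoord_eq_inner_orthogonalProjectionOnto (V : Submodule ℝ E) (w : E)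
    (i : Fin (Module.finrank ℝ V)) :
    projCoord V rfl w i = inner ℝ (stdOrthonormalBasis ℝ V i) (V.orthogonalProjectionOnto w) := by
  have h0 := Submodule.inner_right_of_mem_orthogonal (stdOrthonormalBasis ℝ V i).2
    (V.sub_starProjection_mem_orthogonal w)
  rw [inner_sub_right] at h0
  exact sub_eq_zero.1 h0

lemma abs_projCoord_le (V : Submodule ℝ E) {n : ℕ} (h : Module.finrank ℝ V = n) (w : E)
    (i : Fin n) : |projCoord V h w i| ≤ ‖V.starProjection w‖ := by
  subst h
  rw [projCoord_eq_inner_orthogonalProjectionOnto]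
  have h1 := abs_real_inner_le_norm (stdOrthonormalBasis ℝ V i) (V.orthogonalProjectionOnto w)
  rwa [(stdOrthonormalBasis ℝ V).orthonormal.1 i, one_mul] at h1

lemma norm_starProjection_le_sum (V : Submodule ℝ E) {n : ℕ} (h : Module.finrank ℝ V = n)
    (w : E) : ‖V.starProjection w‖ ≤ ∑ i, |projCoord V h w i| := by
  subst h
  have h1 := (stdOrthonormalBasis ℝ V).sum_repr' (V.orthogonalProjectionOnto w)
  change ‖V.orthogonalProjectionOnto w‖ ≤ _
  rw [← h1]
  refine (norm_sum_le _ _).trans (Finset.sum_le_sum fun i _ => ?_)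
  rw [norm_smul, (stdOrthonormalBasis ℝ V).orthonormal.1 i, mul_one,
    projCoord_eq_inner_orthogonalProjectionOnto, Real.norm_eq_abs]

/-- The splitting of a vector along a flag `B ≤ A`. -/
lemma eq_add_add_starProjection {A B : Submodule ℝ E} (hBA : B ≤ A) (w : E) :
    w = B.starProjection w + (A ⊓ Bᗮ).starProjection w + Aᗮ.starProjection w := by
  have hA : w - A.starProjection w ∈ Aᗮ := A.sub_starProjection_mem_orthogonal w
  have hB : w - B.starProjection w ∈ Bᗮ := B.sub_starProjection_mem_orthogonal w
  have h1 : Aᗮ.starProjection w = w - A.starProjection w := by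
    simp [Submodule.starProjection_orthogonal]
  have h2 : (A ⊓ Bᗮ).starProjection w = A.starProjection w - B.starProjection w := by
    have hmem : A.starProjection w - B.starProjection w ∈ A ⊓ Bᗮ := by
      refine Submodule.mem_inf.2 ⟨?_, ?_⟩
      · exact A.sub_mem (A.starProjection_apply_mem w) (hBA (B.starProjection_apply_mem w))
      · have h := Bᗮ.sub_mem hB (Submodule.orthogonal_le hBA hA)
        rwa [sub_sub_sub_cancel_left] at h
    refine Submodule.eq_starProjection_of_mem_of_inner_eq_zero hmem fun v hv => ?_
    have e1 := Submodule.inner_left_of_mem_orthogonal hv.1 hA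
    have e2 := Submodule.inner_right_of_mem_orthogonal (B.starProjection_apply_mem w) hv.2
    have : w - (A.starProjection w - B.starProjection w)
        = (w - A.starProjection w) + B.starProjection w := by abel
    rw [this, inner_add_left, e1, e2, add_zero]
  rw [h1, h2]
  abel

lemma norm_starProjection_orthogonal_le_infDist (A : Submodule ℝ E) (w : E) :
    ‖Aᗮ.starProjection w‖ ≤ Metric.infDist w (A : Set E) := by
  refine (Metric.le_infDist ⟨0, A.zero_mem⟩).2 fun v hv => ?_
  have hv0 : Aᗮ.starProjection v = 0 :=
    (Submodule.starProjection_apply_eq_zero_iff _).2 (by simpa using hv)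
  rw [dist_eq_norm, ← sub_zero (Aᗮ.starProjection w), ← hv0, ← map_sub]
  exact Submodule.norm_starProjection_apply_le _ _

end Projections

/-- Pigeonhole over a grid: points with coordinates bounded by `R i` that are separated at
scale `t i` are few. -/
lemma card_le_prod_of_separated {ι α : Type*} [Fintype ι] [DecidableEq ι] (S : Finset α)
    (f : α → ι → ℝ) (R t : ι → ℝ) (ht : ∀ i, 0 < t i) (hR0 : ∀ i, 0 ≤ R i)
    (hR : ∀ z ∈ S, ∀ i, |f z i| ≤ R i)
    (hsep : ∀ z ∈ S, ∀ z' ∈ S, (∀ i, |f z i - f z' i| < t i) → z = z') :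
    (S.card : ℝ) ≤ ∏ i, (2 * R i / t i + 2) := by
  have hcard : S.card ≤
      (Fintype.piFinset fun i => Finset.Icc ⌊-(R i / t i)⌋ ⌊R i / t i⌋).card := by
    refine Finset.card_le_card_of_injOn (fun z i => ⌊f z i / t i⌋) ?_ ?_
    · intro z hz
      simp only [Finset.mem_coe, Fintype.mem_piFinset, Finset.mem_Icc]
      intro i
      have h := abs_le.1 (hR z hz i)
      constructor
      · apply Int.floor_le_floor
        rw [← neg_div]
        exact div_le_div_of_nonneg_right h.1 (ht i).le
      · apply Int.floor_le_floor
        exact div_le_div_of_nonneg_right h.2 (ht i).le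
    · intro z hz z' hz' h
      refine hsep z hz z' hz' fun i => ?_
      have h1 := Int.abs_sub_lt_one_of_floor_eq_floor (congrFun h i)
      rwa [← sub_div, abs_div, abs_of_pos (ht i), div_lt_one (ht i)] at h1
  rw [Fintype.card_piFinset] at hcard
  calc (S.card : ℝ) ≤ ((∏ i, (Finset.Icc ⌊-(R i / t i)⌋ ⌊R i / t i⌋).card : ℕ) : ℝ) := by
        exact_mod_cast hcard
    _ = ∏ i, ((Finset.Icc ⌊-(R i / t i)⌋ ⌊R i / t i⌋).card : ℝ) := by push_cast; rfl
    _ ≤ _ := by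
        refine Finset.prod_le_prod (fun _ _ => by positivity) fun i _ => ?_
        have hq : 0 ≤ R i / t i := div_nonneg (hR0 i) (ht i).le
        have h1 : ⌊-(R i / t i)⌋ ≤ ⌊R i / t i⌋ + 1 := by
          have := Int.floor_le_floor (show -(R i / t i) ≤ R i / t i by linarith)
          omega
        have h2 : ((Finset.Icc ⌊-(R i / t i)⌋ ⌊R i / t i⌋).card : ℝ)
            = (⌊R i / t i⌋ : ℝ) + 1 - ⌊-(R i / t i)⌋ := by
          have := Int.card_Icc_of_le _ _ h1
          exact_mod_cast this
        rw [h2, mul_div_assoc]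
        have h3 := Int.floor_le (R i / t i)
        have h4 := Int.lt_floor_add_one (-(R i / t i))
        linarith

section IntVec

variable {d : ℕ}

/-- The sup-norm of an integer vector, as a natural number. -/
def intNorm (z : Fin d → ℤ) : ℕ := Finset.univ.sup fun i => (z i).natAbs

lemma intVec_apply (z : Fin d → ℤ) (i : Fin d) : intVec z i = (z i : ℝ) := rfl

lemma intVec_sub (z z' : Fin d → ℤ) : intVec (z - z') = intVec z - intVec z' := by
  ext i
  simp [intVec_apply]

lemma intVec_nsmul (n : ℕ) (z : Fin d → ℤ) : intVec (n • z) = (n : ℝ) • intVec z := by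
  ext i
  simp [intVec_apply]

lemma abs_intVec_le (z : Fin d → ℤ) (i : Fin d) : |intVec z i| ≤ (intNorm z : ℝ) := by
  have h : (z i).natAbs ≤ intNorm z :=
    Finset.le_sup (f := fun i => (z i).natAbs) (Finset.mem_univ i)
  rw [intVec_apply, ← Int.cast_abs, Int.abs_eq_natAbs, Int.cast_natCast]
  exact Nat.cast_le.2 h

lemma supNorm_intVec (hd : 0 < d) (z : Fin d → ℤ) : supNorm (intVec z) = (intNorm z : ℝ) := by
  have : Nonempty (Fin d) := ⟨⟨0, hd⟩⟩
  refine le_antisymm (ciSup_le fun i => abs_intVec_le z i) ?_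
  obtain ⟨i, -, hi⟩ := Finset.exists_mem_eq_sup (Finset.univ : Finset (Fin d))
    Finset.univ_nonempty fun i => (z i).natAbs
  have h2 : (intNorm z : ℝ) = |intVec z i| := by
    rw [intVec_apply, ← Int.cast_abs, ← Nat.cast_natAbs]
    exact_mod_cast hi
  rw [h2]
  exact le_ciSup (f := fun i => |intVec z i|) (Set.finite_range _).bddAbove i

lemma one_le_intNorm {z : Fin d → ℤ} (hz : z ≠ 0) : 1 ≤ intNorm z := by
  obtain ⟨i, hi⟩ := Function.ne_iff.1 hz
  exact (Nat.one_le_iff_ne_zero.2 (Int.natAbs_ne_zero.2 hi)).trans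
    (Finset.le_sup (f := fun i => (z i).natAbs) (Finset.mem_univ i))

lemma intNorm_le_norm (hd : 0 < d) (z : Fin d → ℤ) : (intNorm z : ℝ) ≤ ‖intVec z‖ := by
  have : Nonempty (Fin d) := ⟨⟨0, hd⟩⟩
  rw [← supNorm_intVec hd]
  exact ciSup_le fun i => by simpa using PiLp.norm_apply_le (intVec z) i

lemma norm_intVec_le (z : Fin d → ℤ) : ‖intVec z‖ ≤ d * intNorm z := by
  have h1 : intVec z = ∑ i, EuclideanSpace.single i (intVec z i) := by
    ext j
    simp
  rw [h1]
  refine (norm_sum_le _ _).trans ?_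
  calc ∑ i, ‖EuclideanSpace.single i (intVec z i)‖ ≤ ∑ _i : Fin d, (intNorm z : ℝ) := by
        refine Finset.sum_le_sum fun i _ => ?_
        simpa using abs_intVec_le z i
    _ = _ := by simp

/-- The integer vectors of sup-norm at most `n`. -/
def intBox (d n : ℕ) : Finset (Fin d → ℤ) :=
  Fintype.piFinset fun _ => Finset.Icc (-(n : ℤ)) n

lemma mem_intBox {n : ℕ} {z : Fin d → ℤ} : z ∈ intBox d n ↔ intNorm z ≤ n := by
  simp only [intBox, Fintype.mem_piFinset, Finset.mem_Icc, intNorm, Finset.sup_le_iff,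
    Finset.mem_univ, true_implies]
  exact forall_congr' fun i => by omega

lemma card_intBox_one : (intBox d 1).card = 3 ^ d := by
  simp [intBox]

end IntVec

/-- The main counting bound: in the shell `Y < |z| ≤ 2Y` there are at most `O(μ_Y)` integer
vectors that are `φ(|z|)`-close to `A`. -/
lemma exists_card_shell_le {d a b : ℕ} (hba : b ≤ a) (had : a ≤ d) (hbd : b < d) {ψ φ : ℝ → ℝ}
    (hψpos : ∀ T : ℝ, 1 ≤ T → 0 < ψ T) (hφpos : ∀ T : ℝ, 1 ≤ T → 0 < φ T)
    (hψanti : AntitoneOn ψ (Set.Ici 1)) (hφanti : AntitoneOn φ (Set.Ici 1))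
    (hψ1 : ∀ T : ℝ, 1 ≤ T → ψ T ≤ 1)
    {B A : Submodule ℝ (EuclideanSpace ℝ (Fin d))} (hBA : B ≤ A)
    (hdimB : Module.finrank ℝ B = b) (hdimA : Module.finrank ℝ A = a)
    (hbad : ∀ z : Fin d → ℤ, z ≠ 0 →
      ψ (intNorm z) ≤ Metric.infDist (intVec z) (B : Set (EuclideanSpace ℝ (Fin d)))) :
    ∃ K : ℝ, 0 ≤ K ∧ ∀ (Y : ℝ) (S : Finset (Fin d → ℤ)), 1 ≤ Y →
      (∀ z ∈ S, Y < intNorm z ∧ (intNorm z : ℝ) ≤ 2 * Y ∧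
        Metric.infDist (intVec z) (A : Set (EuclideanSpace ℝ (Fin d))) < φ (intNorm z)) →
      (S.card : ℝ) ≤ K * muF a b d ψ φ Y := by
  have hd : 0 < d := by omega
  have hdimM : Module.finrank ℝ (A ⊓ Bᗮ : Submodule ℝ (EuclideanSpace ℝ (Fin d))) = a - b := by
    have := Submodule.finrank_add_inf_finrank_orthogonal hBA
    rw [inf_comm] at this
    omega
  have hdimN : Module.finrank ℝ Aᗮ = d - a := by
    have := Submodule.finrank_add_finrank_orthogonal A
    rw [finrank_euclideanSpace_fin] at this
    omega
  set k : ℝ := (d : ℝ) + 1 with hk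
  have hk1 : 1 ≤ k := by simp [hk]
  have hk0 : 0 < k := by linarith
  set K : ℝ := 4 * k ^ 2 + 2 with hK
  have hK0 : 0 < K := by positivity
  refine ⟨K ^ b * (K ^ (a - b) * K ^ (d - a)), by positivity, fun Y S hY hS => ?_⟩
  have hs := hψpos Y hY
  have hs1 := hψ1 Y hY
  have hr := hφpos Y hY
  set s := ψ Y
  set r := φ Y
  let f : (Fin d → ℤ) → (Fin b ⊕ (Fin (a - b) ⊕ Fin (d - a))) → ℝ := fun z =>
    Sum.elim (projCoord B hdimB (intVec z))
      (Sum.elim (projCoord (A ⊓ Bᗮ) hdimM (intVec z)) (projCoord Aᗮ hdimN (intVec z)))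
  let R : (Fin b ⊕ (Fin (a - b) ⊕ Fin (d - a))) → ℝ :=
    Sum.elim (fun _ => d * (2 * Y)) (Sum.elim (fun _ => d * (2 * Y)) (fun _ => r))
  let t : (Fin b ⊕ (Fin (a - b) ⊕ Fin (d - a))) → ℝ :=
    Sum.elim (fun _ => Y / k) (Sum.elim (fun _ => s / k) (fun _ => s / k))
  have hmain := card_le_prod_of_separated S f R t ?_ ?_ ?_ ?_
  · rw [Fintype.prod_sum_type, Fintype.prod_sum_type] at hmain
    simp only [R, t, Sum.elim_inl, Sum.elim_inr, Finset.prod_const, Finset.card_univ,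
      Fintype.card_fin] at hmain
    refine hmain.trans ?_
    have hdk : (d : ℝ) ≤ k := by simp [hk]
    have e1 : 2 * ((d : ℝ) * (2 * Y)) / (Y / k) + 2 ≤ K := by
      have : 2 * ((d : ℝ) * (2 * Y)) / (Y / k) = 4 * (d * k) := by
        field_simp
        ring
      rw [this, hK]
      nlinarith
    have hYs : 1 ≤ Y / s := by rw [one_le_div hs]; linarith
    have e2 : 2 * ((d : ℝ) * (2 * Y)) / (s / k) + 2 ≤ K * (Y / s) := by
      have : 2 * ((d : ℝ) * (2 * Y)) / (s / k) = 4 * (d * k) * (Y / s) := by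
        field_simp
        ring
      rw [this, hK]
      have : 4 * (d * k) ≤ 4 * k ^ 2 := by nlinarith
      nlinarith
    have e3 : 2 * r / (s / k) + 2 ≤ K * max 1 (r / s) := by
      have : 2 * r / (s / k) = 2 * k * (r / s) := by
        field_simp
      rw [this, hK]
      have h1 : 1 ≤ max 1 (r / s) := le_max_left _ _
      have h2 : r / s ≤ max 1 (r / s) := le_max_right _ _
      have h3 : 2 * k ≤ 4 * k ^ 2 := by nlinarith
      have h4 : 2 * k * (r / s) ≤ 4 * k ^ 2 * max 1 (r / s) := by gcongr
      linarith
    have hmax : max 1 (r / s) ^ (d - a) = max 1 ((r / s) ^ (d - a)) := by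
      rcases le_total 1 (r / s) with h | h
      · rw [max_eq_right h, max_eq_right (one_le_pow₀ h)]
      · rw [max_eq_left h, max_eq_left (pow_le_one₀ (by positivity) h), one_pow]
    have hmu : muF a b d ψ φ Y = (Y / s) ^ (a - b) * max 1 (r / s) ^ (d - a) := by
      rw [muF, if_neg (not_lt.2 hY), hmax]
    rw [hmu]
    calc _ ≤ K ^ b * ((K * (Y / s)) ^ (a - b) * (K * max 1 (r / s)) ^ (d - a)) := by gcongr
      _ = _ := by rw [mul_pow, mul_pow]; ring
  · rintro (i | i | i) <;> simp only [t, Sum.elim_inl, Sum.elim_inr] <;> positivity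
  · rintro (i | i | i) <;> simp only [R, Sum.elim_inl, Sum.elim_inr] <;> positivity
  · intro z hz
    obtain ⟨h1, h2, h3⟩ := hS z hz
    have hn : ‖intVec z‖ ≤ d * (2 * Y) :=
      (norm_intVec_le z).trans (by gcongr)
    rintro (i | i | i) <;> simp only [f, R, Sum.elim_inl, Sum.elim_inr] <;>
      refine (abs_projCoord_le _ _ _ _).trans ?_
    · exact (Submodule.norm_starProjection_apply_le _ _).trans hn
    · exact (Submodule.norm_starProjection_apply_le _ _).trans hn
    · exact (norm_starProjection_orthogonal_le_infDist A _).trans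
        (h3.le.trans (hφanti (Set.mem_Ici.2 hY) (Set.mem_Ici.2 (hY.trans h1.le)) h1.le))
  · intro z hz z' hz' hclose
    by_contra hne
    have hsub : z - z' ≠ 0 := sub_ne_zero.2 hne
    set w := intVec (z - z') with hw
    have hwsub : w = intVec z - intVec z' := intVec_sub z z'
    have hsum : ∀ (V : Submodule ℝ (EuclideanSpace ℝ (Fin d))) (n : ℕ)
        (h : Module.finrank ℝ V = n) (u : ℝ),
        (∀ i, |projCoord V h (intVec z) i - projCoord V h (intVec z') i| < u / k) →
        ‖V.starProjection w‖ ≤ n * (u / k) := by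
      intro V n h u hu
      refine (norm_starProjection_le_sum V h w).trans ?_
      calc ∑ i, |projCoord V h w i| ≤ ∑ _i : Fin n, u / k := by
            refine Finset.sum_le_sum fun i _ => ?_
            rw [hwsub, projCoord_sub]
            exact (hu i).le
        _ = _ := by simp
    have hB := hsum B b hdimB Y fun i => by simpa [f, t] using hclose (Sum.inl i)
    have hM := hsum _ (a - b) hdimM s fun i => by simpa [f, t] using hclose (Sum.inr (Sum.inl i))
    have hN := hsum _ (d - a) hdimN s fun i => by simpa [f, t] using hclose (Sum.inr (Sum.inr i))
    have hdec := eq_add_add_starProjection hBA w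
    have hdist : Metric.infDist w (B : Set (EuclideanSpace ℝ (Fin d))) ≤
        (a - b : ℕ) * (s / k) + (d - a : ℕ) * (s / k) := by
      refine (Metric.infDist_le_dist_of_mem (B.starProjection_apply_mem w)).trans ?_
      rw [dist_eq_norm]
      have : w - B.starProjection w = (A ⊓ Bᗮ).starProjection w + Aᗮ.starProjection w := by
        nth_rewrite 1 [hdec]
        abel
      rw [this]
      exact (norm_add_le _ _).trans (add_le_add hM hN)
    have hcast : ((a - b : ℕ) : ℝ) + (d - a : ℕ) + b = d := by
      exact_mod_cast (by omega : (a - b) + (d - a) + b = d)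
    have hsk : 0 < s / k := by positivity
    have hsY : s / k ≤ Y / k := by gcongr; linarith
    have hnorm : ‖w‖ ≤ Y := by
      have h1 : ‖w‖ ≤ b * (Y / k) + (a - b : ℕ) * (s / k) + (d - a : ℕ) * (s / k) := by
        nth_rewrite 1 [hdec]
        exact (norm_add₃_le).trans (by gcongr)
      have h2 : ((a - b : ℕ) : ℝ) * (s / k) ≤ (a - b : ℕ) * (Y / k) := by gcongr
      have h3 : ((d - a : ℕ) : ℝ) * (s / k) ≤ (d - a : ℕ) * (Y / k) := by gcongr
      have h4 : k * (Y / k) = Y := by field_simp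
      have h5 : 0 < Y / k := by positivity
      have h6 : (((a - b : ℕ) : ℝ) + (d - a : ℕ) + b + 1) * (Y / k) = Y := by
        rw [hcast, ← hk, h4]
      linarith
    have hle : (intNorm (z - z') : ℝ) ≤ Y := (intNorm_le_norm hd _).trans hnorm
    have h1 : (1 : ℝ) ≤ intNorm (z - z') := by exact_mod_cast one_le_intNorm hsub
    have hge : s ≤ ψ (intNorm (z - z')) :=
      hψanti (Set.mem_Ici.2 h1) (Set.mem_Ici.2 hY) hle
    have h4 : k * (s / k) = s := by field_simp
    have h6 : (((a - b : ℕ) : ℝ) + (d - a : ℕ) + b + 1) * (s / k) = s := by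
      rw [hcast, ← hk, h4]
    have h7 : 0 ≤ (b : ℝ) * (s / k) := by positivity
    have h8 := hbad _ hsub
    linarith

section Summation

/-- Abel summation: a counting function dominated by `M` sums against an antitone weight no
faster than the increments of `M`. -/
lemma sum_sub_mul_le_of_antitone {N M w : ℕ → ℝ} (hN0 : N 0 = 0) (hM0 : M 0 = 0)
    (hNM : ∀ n, 1 ≤ n → N n ≤ M n) (hw0 : ∀ n, 1 ≤ n → 0 ≤ w n)
    (hw : ∀ n, 1 ≤ n → w (n + 1) ≤ w n) (n : ℕ) :
    ∑ T ∈ Finset.range n, (N (T + 1) - N T) * w (T + 1) ≤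
      ∑ T ∈ Finset.range n, (M (T + 1) - M T) * w (T + 1) := by
  rcases n with _ | n
  · simp
  have key : (M (n + 1) - N (n + 1)) * w (n + 1) ≤
      ∑ T ∈ Finset.range (n + 1), (M (T + 1) - M T) * w (T + 1) -
        ∑ T ∈ Finset.range (n + 1), (N (T + 1) - N T) * w (T + 1) := by
    induction n with
    | zero => simp [hN0, hM0, sub_mul]
    | succ n ih =>
      rw [Finset.sum_range_succ _ (n + 1), Finset.sum_range_succ _ (n + 1)]
      have h1 := hNM (n + 1) (by omega)
      have h2 := hw (n + 1) (by omega)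
      nlinarith
  have h0 : 0 ≤ (M (n + 1) - N (n + 1)) * w (n + 1) :=
    mul_nonneg (sub_nonneg.2 (hNM _ (by omega))) (hw0 _ (by omega))
  linarith

variable {d : ℕ}

open Classical in
/-- The part of a set of integer vectors that consists of nonzero vectors of norm at most `n`. -/
def boxFilter (P : (Fin d → ℤ) → Prop) (n : ℕ) : Finset (Fin d → ℤ) :=
  (intBox d n).filter fun z => z ≠ 0 ∧ P z

lemma mem_boxFilter {P : (Fin d → ℤ) → Prop} {n : ℕ} {z : Fin d → ℤ} :
    z ∈ boxFilter P n ↔ intNorm z ≤ n ∧ z ≠ 0 ∧ P z := by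
  simp [boxFilter, mem_intBox]

lemma boxFilter_zero (P : (Fin d → ℤ) → Prop) : boxFilter P 0 = ∅ := by
  ext z
  simp only [mem_boxFilter, Finset.notMem_empty, iff_false, not_and]
  intro h hz
  have := one_le_intNorm hz
  omega

lemma boxFilter_mono (P : (Fin d → ℤ) → Prop) {m n : ℕ} (h : m ≤ n) :
    boxFilter P m ⊆ boxFilter P n := fun z hz => by
  rw [mem_boxFilter] at *
  exact ⟨hz.1.trans h, hz.2⟩

lemma card_boxFilter_one_le (P : (Fin d → ℤ) → Prop) : (boxFilter P 1).card ≤ 3 ^ d := by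
  rw [← card_intBox_one]
  exact Finset.card_le_card fun z hz => mem_intBox.2 (mem_boxFilter.1 hz).1

/-- Summing a bound for dyadic shells. -/
lemma card_boxFilter_le_sum {P : (Fin d → ℤ) → Prop} {μ : ℝ → ℝ} {K : ℝ}
    (hshell : ∀ (Y : ℝ) (S : Finset (Fin d → ℤ)), 1 ≤ Y →
      (∀ z ∈ S, Y < intNorm z ∧ (intNorm z : ℝ) ≤ 2 * Y ∧ P z) → (S.card : ℝ) ≤ K * μ Y)
    (n : ℕ) (Y : ℝ) (h1 : 2 ^ n ≤ Y) (h2 : Y < 2 ^ (n + 1)) :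
    ((boxFilter P ⌊Y⌋₊).card : ℝ) ≤
      K * ∑ j ∈ Finset.range n, μ (Y / 2 ^ (j + 1)) + 3 ^ d := by
  classical
  induction n generalizing Y with
  | zero =>
    have : ⌊Y⌋₊ = 1 := by
      rw [Nat.floor_eq_iff (by linarith)]
      constructor <;> norm_num at * <;> linarith
    rw [this]
    simpa using (by exact_mod_cast card_boxFilter_one_le P :
      ((boxFilter P 1).card : ℝ) ≤ 3 ^ d)
  | succ n ih =>
    have hih := ih (Y / 2) (by rw [pow_succ] at h1; linarith) (by rw [pow_succ] at h2; linarith)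
    have hY2 : 1 ≤ Y / 2 := by
      have : (1 : ℝ) ≤ 2 ^ n := one_le_pow₀ (by norm_num)
      rw [pow_succ] at h1
      linarith
    have hY0 : 0 ≤ Y := by linarith
    have hdiff := hshell (Y / 2) (boxFilter P ⌊Y⌋₊ \ boxFilter P ⌊Y / 2⌋₊) hY2 fun z hz => by
      rw [Finset.mem_sdiff, mem_boxFilter, mem_boxFilter, Nat.le_floor_iff hY0,
        Nat.le_floor_iff (by linarith)] at hz
      refine ⟨?_, by linarith [hz.1.1], hz.1.2.2⟩
      by_contra hcon
      exact hz.2 ⟨not_lt.1 hcon, hz.1.2⟩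
    have hcard := Finset.card_sdiff_add_card_eq_card
      (boxFilter_mono P (Nat.floor_le_floor (show Y / 2 ≤ Y by linarith)))
    rw [Finset.sum_range_succ']
    have hterm : ∀ j : ℕ, Y / 2 ^ (j + 1 + 1) = Y / 2 / 2 ^ (j + 1) := fun j => by
      rw [pow_succ' _ (j + 1), div_div]
    simp only [hterm, zero_add, pow_one]
    rw [← hcard]
    push_cast
    linarith

lemma muF_nonneg {a b d : ℕ} {ψ φ : ℝ → ℝ} (hψpos : ∀ T : ℝ, 1 ≤ T → 0 < ψ T) (T : ℝ) :
    0 ≤ muF a b d ψ φ T := by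
  unfold muF
  split_ifs with h
  · exact le_rfl
  · have := hψpos T (not_lt.1 h)
    have hT : 0 ≤ T := by linarith
    positivity

lemma one_le_muF {a b d : ℕ} {ψ φ : ℝ → ℝ} (hψpos : ∀ T : ℝ, 1 ≤ T → 0 < ψ T)
    (hψ1 : ∀ T : ℝ, 1 ≤ T → ψ T ≤ 1) {T : ℝ} (hT : 1 ≤ T) : 1 ≤ muF a b d ψ φ T := by
  rw [muF, if_neg (not_lt.2 hT)]
  have hs := hψpos T hT
  have : 1 ≤ T / ψ T := by rw [one_le_div hs]; linarith [hψ1 T hT]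
  exact one_le_mul_of_one_le_of_one_le (one_le_pow₀ this) (le_max_left _ _)

lemma card_boxFilter_le_MF {a b : ℕ} {ψ φ : ℝ → ℝ} (hψpos : ∀ T : ℝ, 1 ≤ T → 0 < ψ T)
    (hψ1 : ∀ T : ℝ, 1 ≤ T → ψ T ≤ 1) {P : (Fin d → ℤ) → Prop} {K : ℝ} (hK : 0 ≤ K)
    (hshell : ∀ (Y : ℝ) (S : Finset (Fin d → ℤ)), 1 ≤ Y →
      (∀ z ∈ S, Y < intNorm z ∧ (intNorm z : ℝ) ≤ 2 * Y ∧ P z) →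
      (S.card : ℝ) ≤ K * muF a b d ψ φ Y) {T : ℕ} (hT : 1 ≤ T) :
    ((boxFilter P T).card : ℝ) ≤ (K + 3 ^ d) * MF a b d ψ φ T := by
  have h1 : 2 ^ Nat.log 2 T ≤ T := Nat.pow_log_le_self 2 (by omega)
  have h2 : T < 2 ^ (Nat.log 2 T + 1) := Nat.lt_pow_succ_log_self (by norm_num) T
  have h := card_boxFilter_le_sum hshell (Nat.log 2 T) (T : ℝ) (by exact_mod_cast h1)
    (by exact_mod_cast h2)
  rw [Nat.floor_natCast] at h
  have hMsum : ∑ j ∈ Finset.range (Nat.log 2 T), muF a b d ψ φ ((T : ℝ) / 2 ^ (j + 1)) ≤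
      MF a b d ψ φ T := by
    rw [MF, Finset.sum_range_succ']
    linarith [muF_nonneg (a := a) (b := b) (d := d) (φ := φ) hψpos ((T : ℝ) / 2 ^ 0)]
  have hM1 : 1 ≤ MF a b d ψ φ T := by
    rw [MF, Finset.sum_range_succ']
    have h3 : 1 ≤ muF a b d ψ φ ((T : ℝ) / 2 ^ 0) :=
      one_le_muF hψpos hψ1 (by simpa using hT)
    linarith [Finset.sum_nonneg fun j (_ : j ∈ Finset.range (Nat.log 2 T)) =>
      muF_nonneg (a := a) (b := b) (d := d) (φ := φ) hψpos ((T : ℝ) / 2 ^ (j + 1))]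
  have h3 : (0 : ℝ) < 3 ^ d := by positivity
  nlinarith [mul_le_mul_of_nonneg_left hMsum hK]

lemma MF_zero {a b d : ℕ} {ψ φ : ℝ → ℝ} : MF a b d ψ φ 0 = 0 := by
  simp [MF, muF]

lemma sum_boxFilter_eq (P : (Fin d → ℤ) → Prop) (w : ℕ → ℝ) (n : ℕ) :
    ∑ z ∈ boxFilter P n, w (intNorm z) = ∑ T ∈ Finset.range n,
      (((boxFilter P (T + 1)).card : ℝ) - (boxFilter P T).card) * w (T + 1) := by
  classical
  induction n with
  | zero => simp [boxFilter_zero]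
  | succ n ih =>
    rw [Finset.sum_range_succ, ← ih]
    have hsub := boxFilter_mono P (Nat.le_succ n)
    rw [← Finset.sum_sdiff hsub, add_comm]
    congr 1
    rw [← Nat.cast_sub (Finset.card_le_card hsub), ← Finset.card_sdiff_of_subset hsub,
      ← nsmul_eq_mul]
    refine Finset.sum_eq_card_nsmul fun z hz => ?_
    rw [Finset.mem_sdiff, mem_boxFilter, mem_boxFilter] at hz
    congr 1
    by_contra hne
    exact hz.2 ⟨by have := hz.1.1; omega, hz.1.2⟩

/-- Convergence of the weighted sum over all integer vectors with the property `P`. -/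
lemma summable_of_card_boxFilter_le {P : (Fin d → ℤ) → Prop} {M w : ℕ → ℝ} (hM0 : M 0 = 0)
    (hPM : ∀ n, 1 ≤ n → ((boxFilter P n).card : ℝ) ≤ M n) (hw0 : ∀ n, 1 ≤ n → 0 ≤ w n)
    (hw : ∀ n, 1 ≤ n → w (n + 1) ≤ w n)
    (hsum : Summable fun T : ℕ => (M (T + 1) - M T) * w (T + 1)) :
    Summable ({z : Fin d → ℤ | z ≠ 0 ∧ P z}.indicator fun z => w (intNorm z)) := by
  classical
  have hnonneg : ∀ z ∈ {z : Fin d → ℤ | z ≠ 0 ∧ P z}, 0 ≤ w (intNorm z) :=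
    fun z hz => hw0 _ (one_le_intNorm hz.1)
  refine summable_of_sum_le (c := ∑' T : ℕ, |(M (T + 1) - M T) * w (T + 1)|)
    (fun z => Set.indicator_nonneg hnonneg z) fun u => ?_
  set n := u.sup intNorm
  calc ∑ z ∈ u, {z : Fin d → ℤ | z ≠ 0 ∧ P z}.indicator (fun z => w (intNorm z)) z
      = ∑ z ∈ u.filter (· ∈ {z : Fin d → ℤ | z ≠ 0 ∧ P z}), w (intNorm z) := by
        rw [Finset.sum_filter]
        exact Finset.sum_congr rfl fun z _ => Set.indicator_apply _ _ _
    _ ≤ ∑ z ∈ boxFilter P n, w (intNorm z) := by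
        refine Finset.sum_le_sum_of_subset_of_nonneg (fun z hz => ?_) fun z hz _ =>
          hnonneg z (mem_boxFilter.1 hz).2
        rw [Finset.mem_filter] at hz
        exact mem_boxFilter.2 ⟨Finset.le_sup hz.1, hz.2⟩
    _ ≤ ∑ T ∈ Finset.range n, (M (T + 1) - M T) * w (T + 1) := by
        rw [sum_boxFilter_eq]
        exact sum_sub_mul_le_of_antitone (N := fun n => ((boxFilter P n).card : ℝ))
          (by simp [boxFilter_zero]) hM0 hPM hw0 hw n
    _ ≤ ∑ T ∈ Finset.range n, |(M (T + 1) - M T) * w (T + 1)| :=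
        Finset.sum_le_sum fun _ _ => le_abs_self _
    _ ≤ _ := hsum.abs.sum_le_tsum _ fun _ _ => abs_nonneg _

end Summation

section Measure

/-- The volume of the intersection of a cube with a slab. -/
lemma volume_slab_le {c : ℕ} (x : Fin c → ℝ) (j₀ : Fin c) (hx : x j₀ ≠ 0) {R r : ℝ}
    (hR : 0 ≤ R) (y : ℝ) :
    volume {θ : Fin c → ℝ | (∀ j, |θ j| ≤ R) ∧ |y - ∑ j, θ j * x j| ≤ r} ≤
      ENNReal.ofReal ((2 * R) ^ (c - 1) * (2 * r) / |x j₀|) := by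
  set M : Matrix (Fin c) (Fin c) ℝ := (1 : Matrix (Fin c) (Fin c) ℝ).updateRow j₀ x
  have hdetM : M.det = x j₀ := by
    rw [← Matrix.cramer_transpose_apply, Matrix.transpose_one, Matrix.cramer_one]
    rfl
  have hdet : LinearMap.det (Matrix.toLin' M) = x j₀ := by
    rw [LinearMap.det_toLin', hdetM]
  set box : Set (Fin c → ℝ) := Set.univ.pi
    (Function.update (fun _ => Set.Icc (-R) R) j₀ (Set.Icc (y - r) (y + r)))
  have hsub : {θ : Fin c → ℝ | (∀ j, |θ j| ≤ R) ∧ |y - ∑ j, θ j * x j| ≤ r} ⊆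
      Matrix.toLin' M ⁻¹' box := by
    rintro θ ⟨h1, h2⟩ j -
    rcases eq_or_ne j j₀ with rfl | hj
    · have hval : Matrix.toLin' M θ j = ∑ i, θ i * x i := by
        simp [M, Matrix.toLin'_apply, Matrix.mulVec, dotProduct, mul_comm]
      rw [hval, Function.update_self]
      have := abs_le.1 h2
      constructor <;> linarith
    · have hval : Matrix.toLin' M θ j = θ j := by
        simp [M, Matrix.toLin'_apply, Matrix.mulVec, dotProduct, Matrix.updateRow_ne hj,
          Matrix.one_apply]
      rw [hval, Function.update_of_ne hj]
      exact abs_le.1 (h1 j)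
  refine (measure_mono hsub).trans ?_
  have hbox : volume box = ENNReal.ofReal ((2 * R) ^ (c - 1) * (2 * r)) := by
    have hrest : ∀ j ∈ Finset.univ.erase j₀, volume (Function.update
        (fun _ => Set.Icc (-R) R) j₀ (Set.Icc (y - r) (y + r)) j) = ENNReal.ofReal (2 * R) :=
      fun j hj => by
        rw [Function.update_of_ne (Finset.ne_of_mem_erase hj), Real.volume_Icc, two_mul,
          sub_neg_eq_add]
    rw [volume_pi_pi, ← Finset.mul_prod_erase _ _ (Finset.mem_univ j₀),
      Finset.prod_congr rfl hrest, Function.update_self, Real.volume_Icc, Finset.prod_const,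
      Finset.card_erase_of_mem (Finset.mem_univ _), Finset.card_univ, Fintype.card_fin,
      ← ENNReal.ofReal_pow (by positivity), mul_comm, ← ENNReal.ofReal_mul (by positivity)]
    congr 2
    ring
  rw [Measure.addHaar_preimage_linearMap _ (by rwa [hdet]), hdet, hbox,
    ← ENNReal.ofReal_mul (abs_nonneg _), abs_inv, mul_comm, div_eq_mul_inv]

lemma volume_forall_slab_le {m c : ℕ} (x : Fin c → ℝ) (j₀ : Fin c) (hx : x j₀ ≠ 0) {R r : ℝ}
    (hR : 0 ≤ R) (hr : 0 ≤ r) (y : Fin m → ℝ) :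
    volume {Θ : Fin m → Fin c → ℝ |
        ∀ i, (∀ j, |Θ i j| ≤ R) ∧ |y i - ∑ j, Θ i j * x j| ≤ r} ≤
      ENNReal.ofReal (((2 * R) ^ (c - 1) * (2 * r) / |x j₀|) ^ m) := by
  have h : {Θ : Fin m → Fin c → ℝ |
      ∀ i, (∀ j, |Θ i j| ≤ R) ∧ |y i - ∑ j, Θ i j * x j| ≤ r} =
      Set.univ.pi fun i => {θ : Fin c → ℝ | (∀ j, |θ j| ≤ R) ∧ |y i - ∑ j, θ j * x j| ≤ r} := by
    ext Θ
    simp [Set.mem_pi]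
  rw [h, volume_pi_pi, ENNReal.ofReal_pow (by positivity)]
  refine (Finset.prod_le_prod' fun i _ => volume_slab_le x j₀ hx hR (y i)).trans_eq ?_
  simp

end Measure

section Graph

variable {d a c : ℕ}

lemma exists_of_mem_graphSub {hca : c ≤ a} {e : Fin a → EuclideanSpace ℝ (Fin d)}
    {Θ : Fin (a - c) → Fin c → ℝ} {v : EuclideanSpace ℝ (Fin d)}
    (hv : v ∈ graphSub d a c hca e Θ) :
    ∃ x : Fin c → ℝ, v = (∑ j : Fin c, x j • e (Fin.castLE hca j)) +
        ∑ i : Fin (a - c), (∑ j : Fin c, Θ i j * x j) • e ⟨c + i.1, by have := i.2; omega⟩ := by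
  induction hv using Submodule.span_induction with
  | mem v hv => exact hv
  | zero => exact ⟨0, by simp⟩
  | add v w _ _ hv hw =>
    obtain ⟨x, hx⟩ := hv
    obtain ⟨y, hy⟩ := hw
    refine ⟨x + y, ?_⟩
    simp only [Pi.add_apply, mul_add, Finset.sum_add_distrib, add_smul]
    rw [hx, hy]
    abel
  | smul t v _ hv =>
    obtain ⟨x, hx⟩ := hv
    refine ⟨t • x, ?_⟩
    simp only [Pi.smul_apply, smul_eq_mul, mul_left_comm _ t, ← Finset.mul_sum, mul_smul,
      ← Finset.smul_sum]
    rw [hx, smul_add]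

lemma graphSub_le {hca : c ≤ a} {e : Fin a → EuclideanSpace ℝ (Fin d)}
    {A : Submodule ℝ (EuclideanSpace ℝ (Fin d))} (hA : ∀ k, e k ∈ A)
    (Θ : Fin (a - c) → Fin c → ℝ) : graphSub d a c hca e Θ ≤ A := by
  intro v hv
  obtain ⟨x, rfl⟩ := exists_of_mem_graphSub hv
  exact A.add_mem (A.sum_mem fun j _ => A.smul_mem _ (hA _))
    (A.sum_mem fun i _ => A.smul_mem _ (hA _))

/-- If `w` is close to the graph of `Θ`, then its last coordinates are close to the image under
`Θ` of its first coordinates, and the first coordinates carry a positive proportion of `‖w‖`. -/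
lemma coord_bounds_of_infDist_lt {hca : c ≤ a} {e : Fin a → EuclideanSpace ℝ (Fin d)}
    (he : Orthonormal ℝ e) {Θ : Fin (a - c) → Fin c → ℝ} {R r : ℝ} (hR : 0 ≤ R)
    (hΘ : ∀ i j, |Θ i j| ≤ R) {w : EuclideanSpace ℝ (Fin d)}
    (hw : Metric.infDist w (graphSub d a c hca e Θ : Set (EuclideanSpace ℝ (Fin d))) < r) :
    (∀ i : Fin (a - c), |inner ℝ (e ⟨c + i.1, by have := i.2; omega⟩) w -
        ∑ j, Θ i j * inner ℝ (e (Fin.castLE hca j)) w| ≤ (1 + c * R) * r) ∧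
      ‖w‖ ≤ r + (1 + a * R) * (∑ j, |inner ℝ (e (Fin.castLE hca j)) w| + c * r) := by
  obtain ⟨v, hv, hdist⟩ := (Metric.infDist_lt_iff ⟨0, Submodule.zero_mem _⟩).1 hw
  rw [dist_eq_norm] at hdist
  have hclose : ∀ k, |inner ℝ (e k) w - inner ℝ (e k) v| ≤ r := fun k => by
    rw [← inner_sub_right]
    refine (abs_real_inner_le_norm _ _).trans ?_
    rw [he.1 k, one_mul]
    exact hdist.le
  obtain ⟨x, hx⟩ := exists_of_mem_graphSub hv
  have hite := orthonormal_iff_ite.1 he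
  have hin1 : ∀ j, inner ℝ (e (Fin.castLE hca j)) v = x j := fun j => by
    have hne : ∀ i : Fin (a - c), Fin.castLE hca j ≠ ⟨c + i.1, by have := i.2; omega⟩ :=
      fun i h => by
        have h1 := Fin.val_eq_of_eq h
        have h2 := j.2
        simp only [Fin.val_castLE] at h1
        omega
    rw [hx, inner_add_right, inner_sum, inner_sum]
    simp [inner_smul_right, hite, hne]
  have hin2 : ∀ i : Fin (a - c), inner ℝ (e ⟨c + i.1, by have := i.2; omega⟩) v =
      ∑ j, Θ i j * x j := fun i => by
    have hne : ∀ j : Fin c, (⟨c + i.1, by have := i.2; omega⟩ : Fin a) ≠ Fin.castLE hca j :=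
      fun j h => by
        have h1 := Fin.val_eq_of_eq h
        have h2 := j.2
        simp only [Fin.val_castLE] at h1
        omega
    rw [hx, inner_add_right, inner_sum, inner_sum]
    simp [inner_smul_right, hite, hne, ← Fin.ext_iff]
  have hr : 0 ≤ r := (norm_nonneg _).trans hdist.le
  constructor
  · intro i
    have h1 := hclose ⟨c + i.1, by have := i.2; omega⟩
    rw [hin2 i] at h1
    have h2 : |∑ j, Θ i j * x j - ∑ j, Θ i j * inner ℝ (e (Fin.castLE hca j)) w| ≤
        c * R * r := by
      rw [← Finset.sum_sub_distrib]
      refine (Finset.abs_sum_le_sum_abs _ _).trans ?_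
      calc _ ≤ ∑ _j : Fin c, R * r := by
            refine Finset.sum_le_sum fun j _ => ?_
            rw [← mul_sub, abs_mul, abs_sub_comm, ← hin1 j]
            exact mul_le_mul (hΘ i j) (hclose _) (abs_nonneg _) hR
        _ = _ := by simp [mul_assoc]
    have h3 := abs_sub_le (inner ℝ (e ⟨c + i.1, by have := i.2; omega⟩) w) (∑ j, Θ i j * x j)
      (∑ j, Θ i j * inner ℝ (e (Fin.castLE hca j)) w)
    linarith
  · have h1 : ∑ j, |x j| ≤ ∑ j, |inner ℝ (e (Fin.castLE hca j)) w| + c * r := by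
      calc ∑ j, |x j| ≤ ∑ j : Fin c, (|inner ℝ (e (Fin.castLE hca j)) w| + r) := by
            refine Finset.sum_le_sum fun j _ => ?_
            have h2 := hclose (Fin.castLE hca j)
            rw [hin1 j, abs_sub_comm] at h2
            linarith [abs_sub_abs_le_abs_sub (x j) (inner ℝ (e (Fin.castLE hca j)) w)]
        _ = _ := by simp [Finset.sum_add_distrib]
    have h2 : ‖v‖ ≤ (1 + a * R) * ∑ j, |x j| := by
      have h3 : ‖∑ j : Fin c, x j • e (Fin.castLE hca j)‖ ≤ ∑ j, |x j| := by
        refine (norm_sum_le _ _).trans_eq (Finset.sum_congr rfl fun j _ => ?_)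
        rw [norm_smul, he.1, mul_one, Real.norm_eq_abs]
      have h4 : ‖∑ i : Fin (a - c), (∑ j : Fin c, Θ i j * x j) •
          e ⟨c + i.1, by have := i.2; omega⟩‖ ≤ a * R * ∑ j, |x j| := by
        refine (norm_sum_le _ _).trans ?_
        calc _ ≤ ∑ _i : Fin (a - c), R * ∑ j, |x j| := by
              refine Finset.sum_le_sum fun i _ => ?_
              rw [norm_smul, he.1, mul_one, Real.norm_eq_abs, Finset.mul_sum]
              refine (Finset.abs_sum_le_sum_abs _ _).trans (Finset.sum_le_sum fun j _ => ?_)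
              rw [abs_mul]
              exact mul_le_mul_of_nonneg_right (hΘ i j) (abs_nonneg _)
          _ = (a - c : ℕ) * (R * ∑ j, |x j|) := by simp
          _ ≤ a * (R * ∑ j, |x j|) := by
              gcongr
              exact Nat.sub_le _ _
          _ = _ := by ring
      rw [hx]
      exact (norm_add_le _ _).trans (by linarith)
    have h3 : ‖w‖ ≤ ‖w - v‖ + ‖v‖ := by simpa using norm_add_le (w - v) v
    have h4 : (1 + a * R) * ∑ j, |x j| ≤
        (1 + a * R) * (∑ j, |inner ℝ (e (Fin.castLE hca j)) w| + c * r) := by gcongr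
    linarith

/-- The volume of the bounded part of the set of `Θ` whose graph is close to a given integer
vector. -/
lemma exists_volume_close_le (hd : 0 < d) (hc : 1 ≤ c) (hca : c ≤ a)
    {e : Fin a → EuclideanSpace ℝ (Fin d)} (he : Orthonormal ℝ e) {R : ℝ} (hR : 0 ≤ R)
    (r₁ : ℝ) :
    ∃ Q T₀ : ℝ, ∀ (z : Fin d → ℤ) (r : ℝ), z ≠ 0 → T₀ ≤ intNorm z → 0 ≤ r → r ≤ r₁ →
      volume {Θ : Fin (a - c) → Fin c → ℝ | (∀ i j, |Θ i j| ≤ R) ∧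
          Metric.infDist (intVec z)
            (graphSub d a c hca e Θ : Set (EuclideanSpace ℝ (Fin d))) < r} ≤
        ENNReal.ofReal (Q * (r ^ (a - c) / (intNorm z : ℝ) ^ (a - c))) := by
  set D : ℝ := 1 + a * R with hD
  have hD0 : 0 < D := by positivity
  have hc0 : (0 : ℝ) < c := by exact_mod_cast hc
  set q : ℝ := (2 * R) ^ (c - 1) * (2 * (1 + c * R)) * (2 * c * D) with hq
  refine ⟨q ^ (a - c), 2 * (r₁ + D * (c * r₁)), fun z r hz hT hr hrr => ?_⟩
  have hn : (0 : ℝ) < intNorm z := by exact_mod_cast one_le_intNorm hz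
  set s := {Θ : Fin (a - c) → Fin c → ℝ | (∀ i j, |Θ i j| ≤ R) ∧
    Metric.infDist (intVec z) (graphSub d a c hca e Θ : Set (EuclideanSpace ℝ (Fin d))) < r}
  rcases s.eq_empty_or_nonempty with hs | ⟨Θ₀, hΘ₀, hclose₀⟩
  · simp [hs]
  have h1 := (coord_bounds_of_infDist_lt he hR hΘ₀ hclose₀).2
  set x : Fin c → ℝ := fun j => inner ℝ (e (Fin.castLE hca j)) (intVec z) with hx
  have hsum : ∑ _j : Fin c, (intNorm z : ℝ) / (2 * c * D) ≤ ∑ j, |x j| := by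
    have h2 := intNorm_le_norm hd z
    have h3 : r + D * (c * r) ≤ r₁ + D * (c * r₁) := by gcongr
    have h4 : D * (∑ j, |x j| + c * r) = D * ∑ j, |x j| + D * (c * r) := mul_add _ _ _
    have h5 : (intNorm z : ℝ) / 2 ≤ D * ∑ j, |x j| := by linarith
    have h6 : ∑ _j : Fin c, (intNorm z : ℝ) / (2 * c * D) = (intNorm z : ℝ) / 2 / D := by
      simp only [Finset.sum_const, Finset.card_univ, Fintype.card_fin, nsmul_eq_mul]
      field_simp
    rw [h6, div_le_iff₀ hD0]
    linarith
  have : Nonempty (Fin c) := ⟨⟨0, hc⟩⟩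
  obtain ⟨j₀, -, hj₀⟩ := Finset.exists_le_of_sum_le Finset.univ_nonempty hsum
  have hxpos : 0 < |x j₀| := lt_of_lt_of_le (by positivity) hj₀
  have hsub : s ⊆ {Θ : Fin (a - c) → Fin c → ℝ | ∀ i, (∀ j, |Θ i j| ≤ R) ∧
      |inner ℝ (e ⟨c + i.1, by have := i.2; omega⟩) (intVec z) - ∑ j, Θ i j * x j| ≤
        (1 + c * R) * r} :=
    fun Θ hΘ i => ⟨hΘ.1 i, (coord_bounds_of_infDist_lt he hR hΘ.1 hΘ.2).1 i⟩
  refine (measure_mono hsub).trans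
    ((volume_forall_slab_le x j₀ (abs_pos.1 hxpos) hR (by positivity) _).trans ?_)
  apply ENNReal.ofReal_le_ofReal
  rw [← div_pow, ← mul_pow]
  refine pow_le_pow_left₀ (by positivity) ?_ _
  calc (2 * R) ^ (c - 1) * (2 * ((1 + c * R) * r)) / |x j₀|
      ≤ (2 * R) ^ (c - 1) * (2 * ((1 + c * R) * r)) / ((intNorm z : ℝ) / (2 * c * D)) := by
        gcongr
    _ = q * (r / intNorm z) := by
        rw [hq]
        field_simp

end Graph

lemma exists_pos_le_of_finite {α : Type*} {F : Set α} (hF : F.Finite) {f : α → ℝ}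
    (hf : ∀ z ∈ F, 0 < f z) : ∃ ρ : ℝ, 0 < ρ ∧ ρ ≤ 1 ∧ ∀ z ∈ F, ρ ≤ f z := by
  induction F, hF using Set.Finite.induction_on with
  | empty => exact ⟨1, one_pos, le_rfl, by simp⟩
  | insert _ _ ih =>
    obtain ⟨ρ, h0, h1, h⟩ := ih fun z hz => hf z (Set.mem_insert_of_mem _ hz)
    refine ⟨min ρ (f _), lt_min h0 (hf _ (Set.mem_insert _ _)), (min_le_left _ _).trans h1, ?_⟩
    rintro z (rfl | hz)
    · exact min_le_right _ _
    · exact (min_le_left _ _).trans (h z hz)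

/-- A subspace with finitely many good integer approximations contains no nonzero integer
vector, hence it is badly approximable after rescaling. -/
lemma exists_badlyApproximable_of_finite {d : ℕ} {φ : ℝ → ℝ}
    (hφpos : ∀ T : ℝ, 1 ≤ T → 0 < φ T) (C : Submodule ℝ (EuclideanSpace ℝ (Fin d)))
    (hfin : {z : Fin d → ℤ | z ≠ 0 ∧
      Metric.infDist (intVec z) (C : Set (EuclideanSpace ℝ (Fin d))) < φ (intNorm z)}.Finite) :
    ∃ ρ : ℝ, 0 < ρ ∧ ρ ≤ 1 ∧ ∀ z : Fin d → ℤ, z ≠ 0 →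
      ρ * φ (intNorm z) ≤ Metric.infDist (intVec z) (C : Set (EuclideanSpace ℝ (Fin d))) := by
  have hφz : ∀ z : Fin d → ℤ, z ≠ 0 → 0 < φ (intNorm z) := fun z hz =>
    hφpos _ (by exact_mod_cast one_le_intNorm hz)
  have hpos : ∀ z : Fin d → ℤ, z ≠ 0 →
      0 < Metric.infDist (intVec z) (C : Set (EuclideanSpace ℝ (Fin d))) := by
    intro z hz
    refine lt_of_le_of_ne Metric.infDist_nonneg fun h0 => ?_
    have hmem : intVec z ∈ C :=
      (C.closed_of_finiteDimensional.mem_iff_infDist_zero ⟨0, C.zero_mem⟩).2 h0.symm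
    have hinj : Function.Injective fun n : ℕ => (n + 1) • z := fun m n hmn => by
      obtain ⟨i, hi⟩ := Function.ne_iff.1 hz
      have h1 : (m + 1) • z i = (n + 1) • z i := congrFun hmn i
      rw [nsmul_eq_mul, nsmul_eq_mul] at h1
      have h2 := mul_right_cancel₀ hi h1
      exact_mod_cast add_right_cancel (Nat.cast_injective h2)
    refine Set.infinite_of_injective_forall_mem hinj (fun n => ?_) hfin
    have hne : (n + 1) • z ≠ 0 := smul_ne_zero (Nat.succ_ne_zero n) hz
    refine ⟨hne, ?_⟩
    have hmem' : intVec ((n + 1) • z) ∈ C := by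
      rw [intVec_nsmul]
      exact C.smul_mem _ hmem
    rw [Metric.infDist_zero_of_mem hmem']
    exact hφz _ hne
  obtain ⟨ρ, h0, h1, h⟩ := exists_pos_le_of_finite hfin
    (f := fun z => Metric.infDist (intVec z) (C : Set (EuclideanSpace ℝ (Fin d))) /
      φ (intNorm z)) fun z hz => div_pos (hpos z hz.1) (hφz z hz.1)
  refine ⟨ρ, h0, h1, fun z hz => ?_⟩
  by_cases hlt :
      Metric.infDist (intVec z) (C : Set (EuclideanSpace ℝ (Fin d))) < φ (intNorm z)
  · exact (le_div_iff₀ (hφz z hz)).1 (h z ⟨hz, hlt⟩)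
  · exact (mul_le_of_le_one_left (hφz z hz).le h1).trans (not_lt.1 hlt)

/-- Theorem 2 of the paper: if `ψ, φ` are positive decreasing functions tending
to `0` with `ψ(T) ≤ T^{−b/(d−b)}`, the series `Σ λ_T φ(T)^{a−c}/T^{a−c}` converges, `B` is a
`b`-dimensional `ψ`-badly approximable subspace of `ℝ^d` and `A ⊇ B` is any `a`-dimensional
subspace, then for almost every `Θ` there are only finitely many nonzero `z ∈ ℤ^d` with
`dist(z, C(Θ)) < φ(|z|)`; in particular `C(Θ)` is `ρφ`-badly approximable for some `ρ ∈ (0,1]`. -/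
theorem stmt_2 (d a b c : ℕ) (hb : 1 ≤ b) (hba : b ≤ a) (had : a ≤ d) (hbd : b < d)
    (hc : 1 ≤ c) (hca : c < a)
    (ψ φ : ℝ → ℝ)
    (hψpos : ∀ T : ℝ, 1 ≤ T → 0 < ψ T) (hφpos : ∀ T : ℝ, 1 ≤ T → 0 < φ T)
    (hψanti : AntitoneOn ψ (Set.Ici 1)) (hφanti : AntitoneOn φ (Set.Ici 1))
    (hψ0 : Tendsto ψ atTop (nhds 0)) (hφ0 : Tendsto φ atTop (nhds 0))
    (hψbound : ∀ T : ℝ, 1 ≤ T → ψ T ≤ T ^ (-(b : ℝ) / ((d : ℝ) - (b : ℝ))))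
    (hsum : Summable (fun T : ℕ =>
      lamF a b d ψ φ T * φ (T : ℝ) ^ (a - c) / (T : ℝ) ^ (a - c)))
    (B A : Submodule ℝ (EuclideanSpace ℝ (Fin d))) (hBA : B ≤ A)
    (hdimB : Module.finrank ℝ B = b) (hdimA : Module.finrank ℝ A = a)
    (hbad : ∀ z : Fin d → ℤ, z ≠ 0 →
      ψ (supNorm (intVec z)) ≤ Metric.infDist (intVec z) (B : Set (EuclideanSpace ℝ (Fin d))))
    (e : Fin a → EuclideanSpace ℝ (Fin d)) (he : Orthonormal ℝ e)
    (hspan : Submodule.span ℝ (Set.range e) = A) :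
    ∀ᵐ Θ ∂(volume : Measure (Fin (a - c) → Fin c → ℝ)),
      {z : Fin d → ℤ | z ≠ 0 ∧
          Metric.infDist (intVec z)
            ((graphSub d a c hca.le e Θ : Submodule ℝ (EuclideanSpace ℝ (Fin d))) :
              Set (EuclideanSpace ℝ (Fin d))) < φ (supNorm (intVec z))}.Finite ∧
      ∃ ρ : ℝ, 0 < ρ ∧ ρ ≤ 1 ∧ ∀ z : Fin d → ℤ, z ≠ 0 →
        ρ * φ (supNorm (intVec z)) ≤
          Metric.infDist (intVec z)
            ((graphSub d a c hca.le e Θ : Submodule ℝ (EuclideanSpace ℝ (Fin d))) :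
              Set (EuclideanSpace ℝ (Fin d))) := by
  have hd : 0 < d := by omega
  simp only [supNorm_intVec hd] at hbad ⊢
  have hψ1 : ∀ T : ℝ, 1 ≤ T → ψ T ≤ 1 := fun T hT =>
    (hψbound T hT).trans (Real.rpow_le_one_of_one_le_of_nonpos hT
      (div_nonpos_of_nonpos_of_nonneg (by simp) (sub_nonneg.2 (by exact_mod_cast hbd.le))))
  obtain ⟨K, hK, hshell⟩ := exists_card_shell_le hba had hbd hψpos hφpos hψanti hφanti hψ1 hBA
    hdimB hdimA hbad
  set P : (Fin d → ℤ) → Prop := fun z =>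
    Metric.infDist (intVec z) (A : Set (EuclideanSpace ℝ (Fin d))) < φ (intNorm z)
  set w : ℕ → ℝ := fun n => φ n ^ (a - c) / (n : ℝ) ^ (a - c) with hw
  have hφn : ∀ n : ℕ, 1 ≤ n → 0 < φ n := fun n hn => hφpos _ (by exact_mod_cast hn)
  have hsummable : Summable
      ({z : Fin d → ℤ | z ≠ 0 ∧ P z}.indicator fun z => w (intNorm z)) := by
    refine summable_of_card_boxFilter_le (M := fun n => (K + 3 ^ d) * MF a b d ψ φ n)
      (by simp [MF_zero]) (fun n hn => card_boxFilter_le_MF hψpos hψ1 hK hshell hn) ?_ ?_ ?_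
    · intro n hn
      have := hφn n hn
      positivity
    · intro n hn
      have h0 : (0 : ℝ) < n := by exact_mod_cast hn
      have h1 : φ ((n + 1 : ℕ) : ℝ) ≤ φ n := hφanti (Set.mem_Ici.2 (by exact_mod_cast hn))
        (Set.mem_Ici.2 (by exact_mod_cast hn.trans (Nat.le_succ n)))
        (by exact_mod_cast Nat.le_succ n)
      have h2 := hφn (n + 1) (by omega)
      have h3 := (hφn n hn).le
      simp only [hw]
      gcongr
      exact Nat.le_succ n
    · refine (((summable_nat_add_iff 1).2 hsum).mul_left (K + 3 ^ d)).congr fun T => ?_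
      simp only [lamF, Nat.add_sub_cancel, hw]
      ring
  have heA : ∀ k, e k ∈ A := fun k => hspan ▸ Submodule.subset_span ⟨k, rfl⟩
  have hball : ∀ R : ℕ, ∃ T₀ : ℝ, ∀ᵐ Θ ∂(volume : Measure (Fin (a - c) → Fin c → ℝ)),
      {z : Fin d → ℤ | (z ≠ 0 ∧ T₀ ≤ intNorm z) ∧ (∀ i j, |Θ i j| ≤ (R : ℝ)) ∧
        Metric.infDist (intVec z) (graphSub d a c hca.le e Θ :
          Set (EuclideanSpace ℝ (Fin d))) < φ (intNorm z)}.Finite := by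
    intro R
    obtain ⟨Q, T₀, hvol⟩ := exists_volume_close_le hd hc hca.le he (Nat.cast_nonneg R) (φ 1)
    refine ⟨T₀, ae_finite_setOfPred_mem (s := fun z : Fin d → ℤ =>
      {Θ : Fin (a - c) → Fin c → ℝ | (z ≠ 0 ∧ T₀ ≤ intNorm z) ∧ (∀ i j, |Θ i j| ≤ (R : ℝ)) ∧
        Metric.infDist (intVec z) (graphSub d a c hca.le e Θ :
          Set (EuclideanSpace ℝ (Fin d))) < φ (intNorm z)}) ?_⟩
    refine ne_top_of_le_ne_top (hsummable.mul_left Q).tsum_ofReal_ne_top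
      (ENNReal.tsum_le_tsum fun z => ?_)
    by_cases hz : (z ≠ 0 ∧ T₀ ≤ intNorm z) ∧ P z
    · rw [Set.indicator_of_mem (show z ∈ {z | z ≠ 0 ∧ P z} from ⟨hz.1.1, hz.2⟩)]
      have h1 := one_le_intNorm hz.1.1
      refine (measure_mono fun Θ hΘ => hΘ.2).trans
        (hvol z (φ (intNorm z)) hz.1.1 hz.1.2 (hφn _ h1).le ?_)
      have h2 : (1 : ℝ) ≤ intNorm z := by exact_mod_cast h1
      exact hφanti (Set.mem_Ici.2 le_rfl) (Set.mem_Ici.2 h2) h2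
    · refine (le_of_eq ?_).trans zero_le
      convert measure_empty (μ := (volume : Measure (Fin (a - c) → Fin c → ℝ)))
      refine Set.eq_empty_of_forall_notMem fun Θ hΘ => hz ⟨hΘ.1, ?_⟩
      exact (Metric.infDist_le_infDist_of_subset (graphSub_le heA Θ)
        ⟨0, Submodule.zero_mem _⟩).trans_lt hΘ.2.2
  choose T₀ hT₀ using hball
  filter_upwards [ae_all_iff.2 hT₀] with Θ hΘ
  have hfin : {z : Fin d → ℤ | z ≠ 0 ∧ Metric.infDist (intVec z)
      (graphSub d a c hca.le e Θ : Set (EuclideanSpace ℝ (Fin d))) < φ (intNorm z)}.Finite := by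
    obtain ⟨R, hR⟩ := exists_nat_ge ‖Θ‖
    refine ((hΘ R).union (intBox d ⌈T₀ R⌉₊).finite_toSet).subset fun z hz => ?_
    rcases le_total (T₀ R) (intNorm z) with h | h
    · exact Or.inl ⟨⟨hz.1, h⟩, fun i j =>
        ((norm_le_pi_norm (Θ i) j).trans (norm_le_pi_norm Θ i)).trans hR, hz.2⟩
    · exact Or.inr (mem_intBox.2 (by exact_mod_cast h.trans (Nat.le_ceil _)))
  exact ⟨hfin, exists_badlyApproximable_of_finite hφpos _ hfin⟩

end
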